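/- Let S be a finite type, let d : S → ℝ be a nonnegative state weighting, let u : S → ℝ, and let τ > 0. Then Σₛ d(s)·ρ_τ(u(s)) is the greatest element of the set { Σₛ d(s)·(2·u(s)·h(s) − h(s)²) : h a function S → ℝ with |h(s)| ≤ τ for all s }; that is, the mean Huber Bellman error equals its conjugate (saddlepoint) reformulation maximized over auxiliary functions clipped to [−τ, τ]. -/

import Mathlib

/-- The Huber function with threshold `τ`. -/
noncomputable def huber (τ a : ℝ) : ℝ :=
  if |a| ≤ τ then a ^ 2 else 2 * τ * |a| - τ ^ 2

/-- Every auxiliary value in `[−τ, τ]` gives a lower bound on the Huber function. -/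
theorem two_mul_mul_sub_sq_le_huber {τ a h : ℝ} (hh : |h| ≤ τ) :
    2 * a * h - h ^ 2 ≤ huber τ a := by
  unfold huber
  split_ifs with ha
  · nlinarith [sq_nonneg (a - h)]
  · have hah : a * h ≤ |a| * |h| := (le_abs_self _).trans_eq (abs_mul a h)
    nlinarith [mul_nonneg (sub_nonneg.2 hh) (by linarith : 0 ≤ 2 * |a| - τ - |h|), sq_abs h]

/-- The Huber function is attained at some auxiliary value in `[−τ, τ]`. -/
theorem exists_huber_eq {τ : ℝ} (hτ : 0 ≤ τ) (a : ℝ) :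
    ∃ h : ℝ, |h| ≤ τ ∧ huber τ a = 2 * a * h - h ^ 2 := by
  unfold huber
  split_ifs with ha
  · exact ⟨a, ha, by ring⟩
  · rcases abs_cases a with ⟨h, -⟩ | ⟨h, -⟩
    · exact ⟨τ, (abs_of_nonneg hτ).le, by rw [h]; ring⟩
    · exact ⟨-τ, by rw [abs_neg, abs_of_nonneg hτ], by rw [h]; ring⟩

/-- The mean Huber Bellman error equals its conjugate (saddlepoint) reformulation
maximized over auxiliary functions clipped to `[−τ, τ]`. -/
theorem mhbe_conjugate (S : Type*) [Fintype S] (d : S → ℝ) (hd : ∀ s, 0 ≤ d s)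
    (u : S → ℝ) (τ : ℝ) (hτ : 0 < τ) :
    IsGreatest
      {y : ℝ | ∃ h : S → ℝ, (∀ s, |h s| ≤ τ) ∧
        y = ∑ s, d s * (2 * u s * h s - h s ^ 2)}
      (∑ s, d s * huber τ (u s)) := by
  constructor
  · choose h hh heq using fun s => exists_huber_eq hτ.le (u s)
    exact ⟨h, hh, Finset.sum_congr rfl fun s _ => by rw [heq s]⟩
  · rintro y ⟨h, hh, rfl⟩
    exact Finset.sum_le_sum fun s _ =>
      mul_le_mul_of_nonneg_left (two_mul_mul_sub_sq_le_huber (hh s)) (hd s)
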